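/- For every n ≥ 0, every nonzero integer m, and every choice of N, r ≥ 1, there exists a polynomial P with rational coefficients in the variables X_α, X_{p,q} (p ≥ 0, q ∈ ℤ), Z^{cd}_p (1 ≤ c, d ≤ r, p ≥ 0), and Y^{cd}_{p,q} (1 ≤ c, d ≤ r, p ≥ 0, q ∈ ℤ, q ≠ 0), involving only finitely many variables with p ≤ n and |q| ≤ |m|, such that: for every commutative ℚ-algebra A, every α ∈ A, all ξ_i^a, η_i^a ∈ A, every invertible N×N matrix K over A, and every N×N matrix L over A satisfying [L, K] = 2FK − 2αK, one has Tr(L^n K^m F) = P, where X_α is evaluated at α, X_{p,q} at Tr(L^p K^q), Z^{cd}_p at Tr(L^p F^{cd}), and Y^{cd}_{p,q} at Tr(L^p K^q F̃^{cd}), with F̃^{cd} := F^{cd} − (δ_{cd}/r) F. -/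

import Mathlib

open Matrix

/-- The rank-one matrices `F^{ab}` with entries `(F^{ab})_{ij} = ξ_i^b η_j^a`. -/
def Fab {A : Type*} [CommRing A] {N r : ℕ} (ξ η : Fin N → Fin r → A)
    (a b : Fin r) : Matrix (Fin N) (Fin N) A :=
  Matrix.of fun i j => ξ i b * η j a

/-- `F = Σ_a F^{aa}`. -/
def Fmat {A : Type*} [CommRing A] {N r : ℕ} (ξ η : Fin N → Fin r → A) :
    Matrix (Fin N) (Fin N) A :=
  ∑ a, Fab ξ η a a

/-- `F̃^{cd} = F^{cd} - (δ_{cd}/r) F`. -/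
def Ftab {A : Type*} [CommRing A] [Algebra ℚ A] {N r : ℕ}
    (ξ η : Fin N → Fin r → A) (c d : Fin r) : Matrix (Fin N) (Fin N) A :=
  Fab ξ η c d - (if c = d then ((r : ℚ)⁻¹) else 0) • Fmat ξ η

/-- Variables: `X_α`; `X_{p,q}` (`p ≤ n`, `|q| ≤ |m|`); `Z^{cd}_p` (`p ≤ n`);
`Y^{cd}_{p,q}` (`p ≤ n`, `|q| ≤ |m|`, `q ≠ 0`). -/
def TrigVars17 (r n : ℕ) (m : ℤ) : Type :=
  Unit ⊕ {pq : ℕ × ℤ // pq.1 ≤ n ∧ pq.2.natAbs ≤ m.natAbs} ⊕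
    ((Fin r × Fin r) × {p : ℕ // p ≤ n}) ⊕
    ((Fin r × Fin r) × {pq : ℕ × ℤ // pq.1 ≤ n ∧ pq.2.natAbs ≤ m.natAbs ∧ pq.2 ≠ 0})

section Commutation

variable {A R : Type*} [CommRing A] [Ring R] [Algebra A R]

/-- Moving `L` through a power of `u`, when `[L, u] = 2 F u - 2 α u`. All exponents of `u`
to the left of `F` lie between `0` and `i`. -/
theorem exists_zpow_mul_eq {α : A} {F L : R} {u : Rˣ}
    (h : L * u - u * L = (2 : A) • (F * u) - (2 * α) • (u : R)) (i : ℤ) :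
    ∃ (ε : ℤ) (f : ℕ → ℤ), (ε = 1 ∨ ε = -1) ∧
      (∀ s < i.natAbs, (0 ≤ f s ∧ f s ≤ i) ∨ (i ≤ f s ∧ f s ≤ 0)) ∧
      (↑(u ^ i) : R) * L = L * ↑(u ^ i) + (2 * i) • (α • (↑(u ^ i) : R)) +
        (2 * ε) • ∑ s ∈ Finset.range i.natAbs, (↑(u ^ f s) : R) * F * ↑(u ^ (i - f s)) := by
  have h₁ : (u : R) * L = L * u + (2 : ℤ) • (α • (u : R)) - (2 : ℤ) • (F * u) := by
    have h₂ : (2 : A) • (F * u) = (2 : ℤ) • (F * (u : R)) := by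
      rw [two_smul, two_smul]
    have h₃ : (2 * α) • (u : R) = (2 : ℤ) • (α • (u : R)) := by
      rw [mul_smul, two_smul, two_smul]
    rw [h₂, h₃] at h
    rw [← sub_eq_zero] at h ⊢
    rw [← neg_eq_zero, ← h]
    abel
  have h₂ : (↑u⁻¹ : R) * L =
      L * ↑u⁻¹ - (2 : ℤ) • (α • (↑u⁻¹ : R)) + (2 : ℤ) • (↑u⁻¹ * F) := by
    have := congrArg (fun x => (↑u⁻¹ : R) * x * ↑u⁻¹) h₁
    simp only [mul_add, mul_sub, add_mul, sub_mul, mul_smul_comm, smul_mul_assoc, mul_assoc,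
      Units.mul_inv, mul_one, Units.inv_mul_cancel_left] at this
    rw [this]
    abel
  obtain ⟨k, rfl | rfl⟩ := i.eq_nat_or_neg
  · refine ⟨-1, fun s => s, Or.inr rfl, fun s hs => Or.inl ?_, ?_⟩
    · dsimp only; omega
    · simp only [Int.natAbs_natCast]
      induction k with
      | zero => simp
      | succ k ih =>
        have e : (↑(u ^ ((k + 1 : ℕ) : ℤ)) : R) = ↑(u ^ (k : ℤ)) * u := by
          rw [← Units.val_mul, Nat.cast_succ, _root_.zpow_add_one]
        have e' : ∀ s : ℕ, (↑(u ^ (((k + 1 : ℕ) : ℤ) - s)) : R) = ↑(u ^ ((k : ℤ) - s)) * u := by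
          intro s
          rw [← Units.val_mul, ← _root_.zpow_add_one]
          congr 2; push_cast; ring
        simp only [Finset.sum_range_succ, e, e', mul_assoc, h₁]
        simp only [mul_add, mul_sub, ← mul_assoc, ih, add_mul, smul_mul_assoc, mul_smul_comm,
          Finset.sum_mul]
        simp only [sub_self, zpow_zero, Units.val_one, mul_one, smul_add]
        push_cast
        module
  · refine ⟨1, fun s => -((s : ℤ) + 1), Or.inl rfl, fun s hs => Or.inr ?_, ?_⟩
    · dsimp only; omega
    · simp only [Int.natAbs_neg, Int.natAbs_natCast]
      induction k with
      | zero => simp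
      | succ k ih =>
        have e : (↑(u ^ (-((k + 1 : ℕ) : ℤ))) : R) = ↑(u ^ (-(k : ℤ))) * ↑u⁻¹ := by
          rw [← Units.val_mul, ← _root_.zpow_sub_one]
          congr 2; push_cast; ring
        have e' : ∀ s : ℕ, (↑(u ^ (-((k + 1 : ℕ) : ℤ) - -((s : ℤ) + 1))) : R) =
            ↑(u ^ (-(k : ℤ) - -((s : ℤ) + 1))) * ↑u⁻¹ := by
          intro s
          rw [← Units.val_mul, ← _root_.zpow_sub_one]
          congr 2; push_cast; ring
        have e'' : (↑(u ^ (-((k : ℤ) + 1))) : R) = ↑(u ^ (-(k : ℤ))) * ↑u⁻¹ := by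
          rw [← e]; push_cast; rfl
        have e₃ : (↑(u ^ (-(k : ℤ) - -((k : ℤ) + 1))) : R) = u := by
          rw [show -(k : ℤ) - -((k : ℤ) + 1) = 1 by ring, zpow_one]
        simp only [Finset.sum_range_succ, e, e', mul_assoc, h₂]
        simp only [mul_add, mul_sub, ← mul_assoc, ih, add_mul, smul_mul_assoc, mul_smul_comm,
          Finset.sum_mul]
        rw [e₃, e'']
        simp only [mul_assoc, Units.mul_inv, mul_one, smul_add]
        push_cast
        module

end Commutation

section TraceFactorization

variable {A : Type*} [CommRing A] {N r : ℕ} (ξ η : Fin N → Fin r → A)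

theorem Fab_eq_vecMulVec (a b : Fin r) :
    Fab ξ η a b = vecMulVec (fun i => ξ i b) (fun j => η j a) := rfl

theorem trace_mul_Fab (X : Matrix (Fin N) (Fin N) A) (a b : Fin r) :
    (X * Fab ξ η a b).trace = (fun j => η j a) ⬝ᵥ X *ᵥ (fun i => ξ i b) := by
  rw [Fab_eq_vecMulVec, mul_vecMulVec, trace_vecMulVec, dotProduct_comm]

theorem trace_mul_Fmat_mul_Fab (X Y : Matrix (Fin N) (Fin N) A) (c d : Fin r) :
    (X * Fmat ξ η * Y * Fab ξ η c d).trace =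
      ∑ a, (X * Fab ξ η c a).trace * (Y * Fab ξ η a d).trace := by
  simp only [Fmat, Matrix.mul_sum, Matrix.sum_mul, trace_sum]
  refine Finset.sum_congr rfl fun a _ => ?_
  rw [trace_mul_Fab, trace_mul_Fab, trace_mul_Fab, Fab_eq_vecMulVec, mul_vecMulVec,
    vecMulVec_mul, vecMulVec_mulVec, ← dotProduct_mulVec]
  simp [dotProduct_smul, mul_comm]

theorem trace_mul_Fmat (X : Matrix (Fin N) (Fin N) A) :
    (X * Fmat ξ η).trace = ∑ a, (X * Fab ξ η a a).trace := by
  simp only [Fmat, Matrix.mul_sum, trace_sum]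

end TraceFactorization

section Subalgebra

variable {A : Type*} [CommRing A] [Algebra ℚ A] {N r : ℕ} {ξ η : Fin N → Fin r → A}
  {α : A} {L : Matrix (Fin N) (Fin N) A} {u : (Matrix (Fin N) (Fin N) A)ˣ} {M : ℕ}
  {S : Subalgebra ℚ A}

/-- Normal ordering of `L ^ a K ^ i L ^ b K ^ j` inside the trace against `F^{cd}`, modulo a
subalgebra that contains all such traces of lower degree in `L`. -/
theorem trace_reorder_sub_mem
    (h : L * u - u * L = (2 : A) • (Fmat ξ η * u) - (2 * α) • (u : Matrix (Fin N) (Fin N) A))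
    (hα : α ∈ S) {n : ℕ}
    (hlow : ∀ p < n, ∀ q : ℤ, q.natAbs ≤ M → ∀ c d,
      (L ^ p * (u ^ q).val * Fab ξ η c d).trace ∈ S) (b : ℕ) :
    ∀ a, a + b ≤ n → ∀ i j : ℤ, i.natAbs ≤ M → j.natAbs ≤ M → (i + j).natAbs ≤ M → ∀ c d,
      (L ^ a * (u ^ i).val * L ^ b * (u ^ j).val * Fab ξ η c d).trace -
        (L ^ (a + b) * (u ^ (i + j)).val * Fab ξ η c d).trace ∈ S := by
  induction b with
  | zero =>
    intro a _ i j _ _ _ c d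
    simp [_root_.zpow_add, mul_assoc]
  | succ b ih =>
    intro a hab i j hi hj hij c d
    have hlow' : ∀ a, a + b < n → ∀ i j : ℤ, i.natAbs ≤ M → j.natAbs ≤ M →
        (i + j).natAbs ≤ M → ∀ c d,
        (L ^ a * (u ^ i).val * L ^ b * (u ^ j).val * Fab ξ η c d).trace ∈ S := by
      intro a hab i j hi hj hij c d
      have := S.add_mem (ih a hab.le i j hi hj hij c d) (hlow (a + b) hab (i + j) hij c d)
      simpa using this
    obtain ⟨ε, f, -, hf, hcomm⟩ := exists_zpow_mul_eq h i
    have key : (L ^ a * (u ^ i).val * L ^ (b + 1) * (u ^ j).val * Fab ξ η c d).trace =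
        (L ^ (a + 1) * (u ^ i).val * L ^ b * (u ^ j).val * Fab ξ η c d).trace +
        (2 * i) • (α * (L ^ a * (u ^ i).val * L ^ b * (u ^ j).val * Fab ξ η c d).trace) +
        (2 * ε) • ∑ s ∈ Finset.range i.natAbs, ∑ e,
          (L ^ a * (u ^ f s).val * Fab ξ η c e).trace *
            ((u ^ (i - f s)).val * L ^ b * (u ^ j).val * Fab ξ η e d).trace := by
      have : L ^ a * (u ^ i).val * L ^ (b + 1) * (u ^ j).val * Fab ξ η c d =
          L ^ a * ((u ^ i).val * L) * L ^ b * (u ^ j).val * Fab ξ η c d := by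
        rw [pow_succ']; simp only [mul_assoc]
      rw [this, hcomm]
      simp only [← trace_mul_Fmat_mul_Fab]
      simp only [mul_add, add_mul, trace_add, mul_smul_comm, smul_mul_assoc, trace_smul,
        Finset.mul_sum, Finset.sum_mul, trace_sum, smul_eq_mul, pow_succ, mul_assoc]
    have hsum : ∑ s ∈ Finset.range i.natAbs, ∑ e,
          (L ^ a * (u ^ f s).val * Fab ξ η c e).trace *
            ((u ^ (i - f s)).val * L ^ b * (u ^ j).val * Fab ξ η e d).trace ∈ S := by
      refine S.sum_mem fun s hs => S.sum_mem fun e _ => S.mul_mem ?_ ?_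
      · have := hf s (Finset.mem_range.1 hs)
        exact hlow a (by omega) _ (by omega) c e
      · have := hf s (Finset.mem_range.1 hs)
        simpa using hlow' 0 (by omega) (i - f s) j (by omega) hj (by omega) e d
    have hmain := ih (a + 1) (by omega) i j hi hj hij c d
    rw [show a + 1 + b = a + (b + 1) by ring] at hmain
    rw [key, add_assoc, add_sub_right_comm]
    exact S.add_mem hmain (S.add_mem
      (zsmul_mem (S.mul_mem hα (hlow' a (by omega) i j hi hj hij c d)) _) (zsmul_mem hsum _))

theorem trace_mul_Fmat_mem
    (h : L * u - u * L = (2 : A) • (Fmat ξ η * u) - (2 * α) • (u : Matrix (Fin N) (Fin N) A))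
    (hα : α ∈ S) {n : ℕ}
    (hlow : ∀ p < n, ∀ q : ℤ, q.natAbs ≤ M → ∀ c d,
      (L ^ p * (u ^ q).val * Fab ξ η c d).trace ∈ S)
    {m : ℤ} (hm : m ≠ 0) (hmM : m.natAbs ≤ M) (hX : (L ^ n * (u ^ m).val).trace ∈ S) :
    (L ^ n * (u ^ m).val * Fmat ξ η).trace ∈ S := by
  obtain ⟨ε, f, hε, hf, hcomm⟩ := exists_zpow_mul_eq h m
  have hzero : (2 * m) • (α * (L ^ n * (u ^ m).val).trace) +
      (2 * ε) • ∑ s ∈ Finset.range m.natAbs,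
        ((u ^ (m - f s)).val * L ^ n * (u ^ f s).val * Fmat ξ η).trace = 0 := by
    have h₁ := congrArg (fun X => (L ^ n * X).trace) hcomm
    have h₂ : (L ^ n * ((u ^ m).val * L)).trace = (L ^ n * (L * (u ^ m).val)).trace := by
      rw [← mul_assoc, trace_mul_comm, ← mul_assoc, ← mul_assoc, pow_mul_comm']
    have h₃ : ∀ s, (L ^ n * ((u ^ f s).val * Fmat ξ η * (u ^ (m - f s)).val)).trace =
        ((u ^ (m - f s)).val * L ^ n * (u ^ f s).val * Fmat ξ η).trace := by
      intro s
      rw [← mul_assoc, trace_mul_comm]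
      simp only [mul_assoc]
    simp only [h₂, mul_add, trace_add, mul_smul_comm, trace_smul, Finset.mul_sum, trace_sum,
      smul_eq_mul, h₃, add_assoc] at h₁
    exact left_eq_add.1 h₁
  have hsum : ∑ s ∈ Finset.range m.natAbs,
        ((u ^ (m - f s)).val * L ^ n * (u ^ f s).val * Fmat ξ η).trace ∈ S := by
    have h₁ : (ε * ε : ℤ) = 1 := by rcases hε with rfl | rfl <;> rfl
    set x := ∑ s ∈ Finset.range m.natAbs,
        ((u ^ (m - f s)).val * L ^ n * (u ^ f s).val * Fmat ξ η).trace
    have h₂ : x = (-(ε * m) : ℤ) • (α * (L ^ n * (u ^ m).val).trace) := by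
      have h₃ := congrArg (fun y => ((2 : ℚ)⁻¹ * ε) • y) hzero
      simp only [smul_add, smul_zero, ← Int.cast_smul_eq_zsmul ℚ, smul_smul] at h₃ ⊢
      have h₄ : (2 : ℚ)⁻¹ * ε * ((2 * ε : ℤ) : ℚ) = 1 := by
        have : (ε * ε : ℚ) = 1 := by exact_mod_cast h₁
        push_cast; linear_combination this
      rw [h₄, one_smul, add_comm] at h₃
      rw [eq_neg_of_add_eq_zero_left h₃, ← neg_smul]
      congr 1
      push_cast; ring
    rw [h₂]
    exact zsmul_mem (S.mul_mem hα hX) _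
  have hdiff : ∑ s ∈ Finset.range m.natAbs,
      (((u ^ (m - f s)).val * L ^ n * (u ^ f s).val * Fmat ξ η).trace -
        (L ^ n * (u ^ m).val * Fmat ξ η).trace) ∈ S := by
    refine S.sum_mem fun s hs => ?_
    have := hf s (Finset.mem_range.1 hs)
    rw [trace_mul_Fmat, trace_mul_Fmat, ← Finset.sum_sub_distrib]
    refine S.sum_mem fun e _ => ?_
    simpa using trace_reorder_sub_mem h hα hlow n 0 (by omega) (m - f s) (f s) (by omega)
      (by omega) (by simpa using hmM) e e
  have hmul := S.sub_mem hsum hdiff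
  rw [Finset.sum_sub_distrib, sub_sub_cancel, Finset.sum_const, Finset.card_range,
    ← Nat.cast_smul_eq_nsmul ℚ] at hmul
  have hne : (m.natAbs : ℚ) ≠ 0 := by simpa using hm
  have hmem := S.smul_mem hmul (m.natAbs : ℚ)⁻¹
  rwa [smul_smul, inv_mul_cancel₀ hne, one_smul] at hmem

theorem trace_mul_Fab_mem
    (h : L * u - u * L = (2 : A) • (Fmat ξ η * u) - (2 * α) • (u : Matrix (Fin N) (Fin N) A))
    (hα : α ∈ S) {n : ℕ}
    (hX : ∀ p ≤ n, ∀ q : ℤ, q.natAbs ≤ M → (L ^ p * (u ^ q).val).trace ∈ S)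
    (hZ : ∀ p ≤ n, ∀ c d, (L ^ p * Fab ξ η c d).trace ∈ S)
    (hY : ∀ p ≤ n, ∀ q : ℤ, q.natAbs ≤ M → q ≠ 0 → ∀ c d,
      (L ^ p * (u ^ q).val * Ftab ξ η c d).trace ∈ S) (p : ℕ) :
    p ≤ n → ∀ q : ℤ, q.natAbs ≤ M → ∀ c d,
      (L ^ p * (u ^ q).val * Fab ξ η c d).trace ∈ S := by
  induction p using Nat.strong_induction_on with
  | _ p ih =>
    intro hp q hq c d
    obtain rfl | hq0 := eq_or_ne q 0
    · simpa using hZ p hp c d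
    have hF := trace_mul_Fmat_mem h hα (fun p' hp' => ih p' hp' (hp'.le.trans hp)) hq0 hq
      (hX p hp q hq)
    have := S.add_mem (hY p hp q hq hq0 c d)
      (S.smul_mem hF (if c = d then ((r : ℚ)⁻¹) else 0))
    simpa only [Ftab, mul_sub, mul_smul_comm, trace_sub, trace_smul, sub_add_cancel] using this

end Subalgebra

/-- A solution `(α, ξ, η, K, L)` of the relation `[L, K] = 2 F K - 2 α K` over some commutative
`ℚ`-algebra. -/
structure TrigSolution (N r : ℕ) where
  A : Type
  [ring : CommRing A]
  [algebra : Algebra ℚ A]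
  α : A
  ξ : Fin N → Fin r → A
  η : Fin N → Fin r → A
  u : (Matrix (Fin N) (Fin N) A)ˣ
  L : Matrix (Fin N) (Fin N) A
  comm : L * u - u * L =
    (2 : A) • (Fmat ξ η * u) - (2 * α) • (u : Matrix (Fin N) (Fin N) A)

attribute [instance] TrigSolution.ring TrigSolution.algebra

/-- The value of a variable at `(α, ξ, η, K, L)`. -/
def trigValue {A : Type*} [CommRing A] [Algebra ℚ A] {N r : ℕ} (n : ℕ) (m : ℤ) (α : A)
    (ξ η : Fin N → Fin r → A) (u : (Matrix (Fin N) (Fin N) A)ˣ)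
    (L : Matrix (Fin N) (Fin N) A) : TrigVars17 r n m → A
  | Sum.inl _ => α
  | Sum.inr (Sum.inl pq) => (L ^ pq.1.1 * (u ^ pq.1.2).val).trace
  | Sum.inr (Sum.inr (Sum.inl cdp)) => (L ^ cdp.2.1 * Fab ξ η cdp.1.1 cdp.1.2).trace
  | Sum.inr (Sum.inr (Sum.inr cdpq)) =>
      (L ^ cdpq.2.1.1 * (u ^ cdpq.2.1.2).val * Ftab ξ η cdpq.1.1 cdpq.1.2).trace

theorem exists_aeval_trigValue {A : Type*} [CommRing A] [Algebra ℚ A] {N r : ℕ} (n : ℕ)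
    (m : ℤ) {α : A} {ξ η : Fin N → Fin r → A}
    {u : (Matrix (Fin N) (Fin N) A)ˣ} {L : Matrix (Fin N) (Fin N) A}
    (h : L * u - u * L =
      (2 : A) • (Fmat ξ η * u) - (2 * α) • (u : Matrix (Fin N) (Fin N) A)) :
    ∃ P : MvPolynomial (TrigVars17 r n m) ℚ,
      MvPolynomial.aeval (trigValue n m α ξ η u L) P =
        (L ^ n * (u ^ m).val * Fmat ξ η).trace := by
  let S := (MvPolynomial.aeval (R := ℚ) (trigValue n m α ξ η u L)).range
  have hS : ∀ v, trigValue n m α ξ η u L v ∈ S := fun v =>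
    ⟨MvPolynomial.X v, by simp⟩
  change _ ∈ S
  rw [trace_mul_Fmat]
  refine S.sum_mem fun c _ => ?_
  exact trace_mul_Fab_mem h (hS (Sum.inl ()))
    (fun p hp q hq => hS (Sum.inr (Sum.inl ⟨(p, q), hp, hq⟩)))
    (fun p hp c d => hS (Sum.inr (Sum.inr (Sum.inl ((c, d), ⟨p, hp⟩)))))
    (fun p hp q hq hq0 c d => hS (Sum.inr (Sum.inr (Sum.inr ((c, d), ⟨(p, q), hp, hq, hq0⟩)))))
    n le_rfl m le_rfl c c

section BaseChange

variable {A B : Type*} [CommRing A] [CommRing B] {N r : ℕ}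

theorem trace_mapMatrix (φ : A →+* B) (X : Matrix (Fin N) (Fin N) A) :
    φ X.trace = (φ.mapMatrix X).trace :=
  AddMonoidHom.map_trace φ X

theorem mapMatrix_zpow (φ : A →+* B) (u : (Matrix (Fin N) (Fin N) A)ˣ) (q : ℤ) :
    φ.mapMatrix (u ^ q).val = (Units.map φ.mapMatrix.toMonoidHom u ^ q).val := by
  rw [← map_zpow]
  rfl

theorem Fab_map (φ : A →+* B) (ξ η : Fin N → Fin r → A) (a b : Fin r) :
    φ.mapMatrix (Fab ξ η a b) = Fab (fun i a => φ (ξ i a)) (fun i a => φ (η i a)) a b := by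
  ext i j
  simp [Fab]

theorem Fmat_map (φ : A →+* B) (ξ η : Fin N → Fin r → A) :
    φ.mapMatrix (Fmat ξ η) = Fmat (fun i a => φ (ξ i a)) (fun i a => φ (η i a)) := by
  simp only [Fmat, map_sum, Fab_map]

theorem Ftab_map [Algebra ℚ A] [Algebra ℚ B] (φ : A →ₐ[ℚ] B) (ξ η : Fin N → Fin r → A)
    (a b : Fin r) :
    (φ : A →+* B).mapMatrix (Ftab ξ η a b) =
      Ftab (fun i a => φ (ξ i a)) (fun i a => φ (η i a)) a b := by
  have h := Fmat_map (φ : A →+* B) ξ η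
  have h' := Fab_map (φ : A →+* B) ξ η a b
  simp only [RingHom.coe_coe] at h h'
  rw [Ftab, Ftab, map_sub, h', ← h]
  congr 1
  ext i j
  split_ifs <;> simp

theorem trigValue_map [Algebra ℚ A] [Algebra ℚ B] (φ : A →ₐ[ℚ] B) (n : ℕ) (m : ℤ) (α : A)
    (ξ η : Fin N → Fin r → A) (u : (Matrix (Fin N) (Fin N) A)ˣ)
    (L : Matrix (Fin N) (Fin N) A) (v : TrigVars17 r n m) :
    φ (trigValue n m α ξ η u L v) =
      trigValue n m (φ α) (fun i a => φ (ξ i a)) (fun i a => φ (η i a))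
        (Units.map (φ : A →+* B).mapMatrix.toMonoidHom u) ((φ : A →+* B).mapMatrix L) v := by
  have htr := trace_mapMatrix (N := N) (φ : A →+* B)
  have hab := Fab_map (φ : A →+* B) ξ η
  simp only [RingHom.coe_coe] at hab htr
  rcases v with _ | pq | cdp | cdpq
  · rfl
  · simp only [trigValue, htr, map_mul, map_pow, mapMatrix_zpow]
  · simp only [trigValue, htr, map_mul, map_pow, hab]
  · simp only [trigValue, htr, map_mul, map_pow, mapMatrix_zpow, Ftab_map]

end BaseChange

section Universal

variable (N r : ℕ)

/-- The product of the base rings of all solutions, over which there is a universal solution. -/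
abbrev TrigProduct : Type 1 := ∀ s : TrigSolution N r, s.A

variable {N r}

/-- The evaluation of the universal solution at a given one. -/
abbrev TrigSolution.eval (s : TrigSolution N r) : TrigProduct N r →ₐ[ℚ] s.A :=
  Pi.evalAlgHom ℚ (fun s : TrigSolution N r => s.A) s

theorem TrigSolution.matrix_ext {X Y : Matrix (Fin N) (Fin N) (TrigProduct N r)}
    (h : ∀ s : TrigSolution N r, (s.eval : _ →+* s.A).mapMatrix X =
      (s.eval : _ →+* s.A).mapMatrix Y) : X = Y := by
  ext i j s
  exact congrFun (congrFun (h s) i) j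

theorem TrigSolution.exists_universal :
    ∃ (α : TrigProduct N r) (ξ η : Fin N → Fin r → TrigProduct N r)
      (u : (Matrix (Fin N) (Fin N) (TrigProduct N r))ˣ)
      (L : Matrix (Fin N) (Fin N) (TrigProduct N r)),
      L * u - u * L = (2 : TrigProduct N r) • (Fmat ξ η * u) -
        (2 * α) • (u : Matrix (Fin N) (Fin N) (TrigProduct N r)) ∧
      ∀ s : TrigSolution N r, s.eval α = s.α ∧ (fun i a => s.eval (ξ i a)) = s.ξ ∧
        (fun i a => s.eval (η i a)) = s.η ∧
        Units.map (s.eval : _ →+* s.A).mapMatrix.toMonoidHom u = s.u ∧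
        (s.eval : _ →+* s.A).mapMatrix L = s.L := by
  let K : Matrix (Fin N) (Fin N) (TrigProduct N r) :=
    Matrix.of fun i j s => (s.u : Matrix (Fin N) (Fin N) s.A) i j
  let K' : Matrix (Fin N) (Fin N) (TrigProduct N r) :=
    Matrix.of fun i j s => (↑s.u⁻¹ : Matrix (Fin N) (Fin N) s.A) i j
  let L : Matrix (Fin N) (Fin N) (TrigProduct N r) := Matrix.of fun i j s => s.L i j
  have hK : ∀ s : TrigSolution N r, (s.eval : _ →+* s.A).mapMatrix K = s.u := fun _ => rfl
  have hK' : ∀ s : TrigSolution N r, (s.eval : _ →+* s.A).mapMatrix K' = ↑s.u⁻¹ := fun _ => rfl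
  have hL : ∀ s : TrigSolution N r, (s.eval : _ →+* s.A).mapMatrix L = s.L := fun _ => rfl
  let u : (Matrix (Fin N) (Fin N) (TrigProduct N r))ˣ :=
    ⟨K, K', matrix_ext fun s => by rw [map_mul, hK, hK', map_one, Units.mul_inv],
      matrix_ext fun s => by rw [map_mul, hK, hK', map_one, Units.inv_mul]⟩
  refine ⟨fun s => s.α, fun i a s => s.ξ i a, fun i a s => s.η i a, u, L,
    matrix_ext fun s => ?_, fun s => ⟨rfl, rfl, rfl, Units.ext (hK s), rfl⟩⟩
  have hsmul : ∀ (x : TrigProduct N r) (X : Matrix (Fin N) (Fin N) (TrigProduct N r)),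
      (s.eval : _ →+* s.A).mapMatrix (x • X) =
        x s • (s.eval : _ →+* s.A).mapMatrix X := fun _ _ => rfl
  rw [map_sub, map_sub, map_mul, map_mul, hsmul, hsmul, map_mul, Fmat_map, hL]
  exact s.comm

end Universal

theorem statement17 (n : ℕ) (m : ℤ) (hm : m ≠ 0) (N r : ℕ) (hN : 1 ≤ N)
    (hr : 1 ≤ r) :
    ∃ P : MvPolynomial (TrigVars17 r n m) ℚ,
      ∀ (A : Type) (_ : CommRing A) (_ : Algebra ℚ A) (α : A)
        (ξ η : Fin N → Fin r → A) (K L : Matrix (Fin N) (Fin N) A), IsUnit K →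
        L * K - K * L = (2 : A) • (Fmat ξ η * K) - (2 * α) • K →
        (L ^ n * K ^ m * Fmat ξ η).trace =
          MvPolynomial.aeval
            (fun v : TrigVars17 r n m =>
              match v with
              | Sum.inl _ => α
              | Sum.inr (Sum.inl pq) => (L ^ pq.1.1 * K ^ pq.1.2).trace
              | Sum.inr (Sum.inr (Sum.inl cdp)) =>
                  (L ^ cdp.2.1 * Fab ξ η cdp.1.1 cdp.1.2).trace
              | Sum.inr (Sum.inr (Sum.inr cdpq)) =>
                  (L ^ cdpq.2.1.1 * K ^ cdpq.2.1.2 *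
                    Ftab ξ η cdpq.1.1 cdpq.1.2).trace) P := by
  obtain ⟨α₀, ξ₀, η₀, u₀, L₀, h₀, hs⟩ := TrigSolution.exists_universal (N := N) (r := r)
  obtain ⟨P, hP⟩ := exists_aeval_trigValue n m h₀
  refine ⟨P, fun A _ _ α ξ η K L hK h => ?_⟩
  obtain ⟨u, rfl⟩ := hK
  let s : TrigSolution N r := ⟨A, α, ξ, η, u, L, h⟩
  obtain ⟨hα, hξ, hη, hu, hL⟩ := hs s
  have hv : ∀ v, s.eval (trigValue n m α₀ ξ₀ η₀ u₀ L₀ v) = trigValue n m α ξ η u L v := by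
    intro v
    rw [trigValue_map, hα, hξ, hη, hu, hL]
  have hF : (s.eval : _ →+* s.A).mapMatrix (Fmat ξ₀ η₀) = Fmat ξ η := by
    rw [Fmat_map]
    exact congrArg₂ Fmat hξ hη
  have htr : s.eval (L₀ ^ n * (u₀ ^ m).val * Fmat ξ₀ η₀).trace =
      (L ^ n * (u ^ m).val * Fmat ξ η).trace := by
    refine (trace_mapMatrix (s.eval : TrigProduct N r →+* s.A) _).trans ?_
    rw [map_mul, map_mul, map_pow, mapMatrix_zpow, hL, hF, hu]
  have hcomp : s.eval (MvPolynomial.aeval (trigValue n m α₀ ξ₀ η₀ u₀ L₀) P) =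
      MvPolynomial.aeval (trigValue n m α ξ η u L) P := by
    rw [← funext hv, ← MvPolynomial.comp_aeval_apply]
  rw [← Matrix.coe_units_zpow]
  refine (htr.symm.trans ((congrArg s.eval hP).symm.trans hcomp)).trans ?_
  congr 2
  funext v
  rcases v with _ | pq | cdp | cdpq <;> simp only [trigValue, Matrix.coe_units_zpow]
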